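/- Let 0 ≤ s ≤ 1 and 0 ≤ t ≤ 1. On pairs of commuting positive definite n×n complex matrices, the function (L,R) ↦ −L^s R^{(1-s)t} is jointly convex in the Loewner order: if L₁ commutes with R₁, L₂ commutes with R₂, all positive definite, 0 ≤ c ≤ 1, L = cL₁+(1-c)L₂ and R = cR₁+(1-c)R₂ commute, then −L^s R^{(1-s)t} ≤ c·(−L₁^s R₁^{(1-s)t}) + (1-c)·(−L₂^s R₂^{(1-s)t}). -/

import Mathlib

open Matrix
open scoped ComplexOrder

/-- The real power `A ^ s` of a matrix, via the continuous functional calculus. -/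
noncomputable def matrixRpow {k : ℕ} (A : Matrix (Fin k) (Fin k) ℂ) (s : ℝ) :
    Matrix (Fin k) (Fin k) ℂ :=
  cfc (fun x : ℝ => x ^ s) A

/-- A closed midpoint-closed set in a real topological vector space is convex. -/
lemma convex_of_isClosed_of_midpoint_mem {E : Type*} [AddCommGroup E] [Module ℝ E]
    [TopologicalSpace E] [ContinuousAdd E] [ContinuousSMul ℝ E] {S : Set E}
    (hS : IsClosed S) (hmid : ∀ x ∈ S, ∀ y ∈ S, (2⁻¹ : ℝ) • (x + y) ∈ S) : Convex ℝ S := by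
  intro x hx y hy a b ha hb hab
  let f : ℝ → E := fun r => (1 - r) • x + r • y
  have hf : Continuous f := by fun_prop
  let T : Set ℝ := f ⁻¹' S
  have hT : IsClosed T := hS.preimage hf
  have hT0 : (0 : ℝ) ∈ T := by simpa [T, f] using hx
  have hT1 : (1 : ℝ) ∈ T := by simpa [T, f] using hy
  have hTmid : ∀ u ∈ T, ∀ v ∈ T, (u + v) / 2 ∈ T := by
    intro u hu v hv
    have h := hmid _ hu _ hv
    have e : (2⁻¹ : ℝ) • (f u + f v) = f ((u + v) / 2) := by
      simp only [f]
      module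
    rwa [e] at h
  suffices hbT : b ∈ T by
    have h : (1 - b) • x + b • y ∈ S := hbT
    rwa [show 1 - b = a by linarith] at h
  by_contra hbT
  have hlow := (hT.inter isClosed_Iic).csSup_mem (s := T ∩ Set.Iic b) ⟨0, hT0, hb⟩
    ⟨b, fun u hu => hu.2⟩
  have hupp := (hT.inter isClosed_Ici).csInf_mem (s := T ∩ Set.Ici b)
    ⟨1, hT1, show b ≤ 1 by linarith⟩ ⟨b, fun u hu => hu.2⟩
  set u := sSup (T ∩ Set.Iic b)
  set v := sInf (T ∩ Set.Ici b)
  have hub : u < b := lt_of_le_of_ne hlow.2 fun h => hbT (h ▸ hlow.1)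
  have hbv : b < v := lt_of_le_of_ne hupp.2 fun h => hbT (h ▸ hupp.1)
  have hm := hTmid u hlow.1 v hupp.1
  rcases le_total ((u + v) / 2) b with h | h
  · have : (u + v) / 2 ≤ u := le_csSup ⟨b, fun w hw => hw.2⟩ ⟨hm, h⟩
    linarith
  · have : v ≤ (u + v) / 2 := csInf_le ⟨b, fun w hw => hw.2⟩ ⟨hm, h⟩
    linarith

namespace Matrix

variable {n : Type*} [Fintype n]

/-- Operator monotonicity of the square root, in squared form. -/
lemma PosDef.posSemidef_sub_of_sq [DecidableEq n] {G Z : Matrix n n ℂ} (hG : G.PosDef)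
    (hZ : Z.IsHermitian) (h : (G * G - Z * Z).PosSemidef) : (G - Z).PosSemidef := by
  have hD : (G - Z).IsHermitian := hG.1.sub hZ
  rw [hD.posSemidef_iff_eigenvalues_nonneg]
  intro i
  by_contra hneg
  simp only [Pi.zero_apply, not_le] at hneg
  set l := hD.eigenvalues i
  set v : n → ℂ := (hD.eigenvectorBasis i).ofLp
  have hv0 : v ≠ 0 := by
    intro h0
    apply hD.eigenvectorBasis.orthonormal.ne_zero i
    ext j
    exact congrFun h0 j
  have hDv : (G - Z) *ᵥ v = l • v := hD.mulVec_eigenvectorBasis i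
  have hZv : Z *ᵥ v = G *ᵥ v - (l : ℂ) • v := by
    rw [sub_mulVec] at hDv
    rw [show (l : ℂ) • v = l • v by ext j; simp, ← hDv]
    abel
  have hsq : ∀ H : Matrix n n ℂ, H.IsHermitian →
      star v ⬝ᵥ (H * H) *ᵥ v = star (H *ᵥ v) ⬝ᵥ H *ᵥ v := by
    intro H hH
    rw [← mulVec_mulVec, dotProduct_mulVec, star_mulVec, hH.eq]
  have hGv : star (G *ᵥ v) ⬝ᵥ v = star v ⬝ᵥ G *ᵥ v := by
    rw [star_mulVec, hG.1.eq, dotProduct_mulVec]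
  have key := h.dotProduct_mulVec_nonneg v
  rw [sub_mulVec, dotProduct_sub, hsq G hG.1, hsq Z hZ, hZv] at key
  have hpos := hG.dotProduct_mulVec_pos hv0
  have hpos' : 0 < star v ⬝ᵥ v := dotProduct_star_self_pos_iff.2 hv0
  have e : star (G *ᵥ v) ⬝ᵥ G *ᵥ v
      - star (G *ᵥ v - (l : ℂ) • v) ⬝ᵥ (G *ᵥ v - (l : ℂ) • v)
      = 2 * (l : ℂ) * (star v ⬝ᵥ G *ᵥ v) - (l : ℂ) ^ 2 * (star v ⬝ᵥ v) := by
    simp only [star_sub, star_smul, sub_dotProduct, dotProduct_sub, smul_dotProduct,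
      dotProduct_smul, hGv, smul_eq_mul]
    simp only [RCLike.star_def, Complex.conj_ofReal]
    ring
  rw [e] at key
  obtain ⟨a, ha⟩ : ∃ a : ℝ, (a : ℂ) = star v ⬝ᵥ G *ᵥ v :=
    ⟨_, (Complex.eq_re_of_ofReal_le (r := 0) (by simpa using hpos.le)).symm⟩
  obtain ⟨b, hb⟩ : ∃ b : ℝ, (b : ℂ) = star v ⬝ᵥ v :=
    ⟨_, (Complex.eq_re_of_ofReal_le (r := 0) (by simp)).symm⟩
  rw [← ha] at key hpos
  rw [← hb] at key hpos'
  norm_cast at key hpos hpos'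
  nlinarith [mul_pos (neg_pos.2 hneg) hpos, mul_nonneg (sq_nonneg l) hpos'.le]

/-- Maximality of the geometric mean: if the block matrix `[[G * Y⁻¹ * G, Z], [Z, Y]]` is positive
semidefinite, then `Z ≤ G`. The matrix `S` is a square root of `Y⁻¹`. -/
lemma PosDef.posSemidef_sub_of_fromBlocks [DecidableEq n] {X Y G S Z : Matrix n n ℂ}
    (hG : G.PosDef) (hY : Y.PosDef) (hS : S.IsHermitian) (hSu : IsUnit S) (hYS : Y⁻¹ = S * S)
    (hX : X = G * Y⁻¹ * G) (hZ : Z.IsHermitian)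
    (h : (fromBlocks X Z Z Y).PosSemidef) : (G - Z).PosSemidef := by
  let _ := hY.isUnit.invertible
  have h' : (fromBlocks X Z Zᴴ Y).PosSemidef := by rwa [hZ.eq]
  rw [PosDef.fromBlocks₂₂ X Z hY, hZ.eq, hX, hYS] at h'
  have hconj : ∀ H : Matrix n n ℂ, star S * H * S = S * H * S := by
    intro H
    rw [star_eq_conjTranspose, hS.eq]
  rw [← IsUnit.posSemidef_star_left_conjugate_iff hSu, hconj] at h' ⊢
  have hG' : (S * G * S).PosDef := by
    rw [← hconj]
    exact (IsUnit.posDef_star_left_conjugate_iff hSu).2 hG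
  have hZ' : (S * Z * S).IsHermitian := by
    have := isHermitian_conjTranspose_mul_mul S hZ
    rwa [hS.eq] at this
  rw [mul_sub, sub_mul]
  apply hG'.posSemidef_sub_of_sq hZ'
  convert h' using 1
  noncomm_ring

lemma PosSemidef.fromBlocks_diagonal {A D : Matrix n n ℂ} (hA : A.PosSemidef)
    (hD : D.PosSemidef) : (fromBlocks A 0 0 D).PosSemidef := by
  refine .of_dotProduct_mulVec_nonneg (hA.1.fromBlocks (by simp) hD.1) fun x => ?_
  rw [fromBlocks_mulVec, ← Sum.elim_comp_inl_inr (star x)]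
  simp only [zero_mulVec, add_zero, zero_add, sumElim_dotProduct_sumElim]
  exact add_nonneg (hA.dotProduct_mulVec_nonneg (x ∘ Sum.inl))
    (hD.dotProduct_mulVec_nonneg (x ∘ Sum.inr))

lemma isClosed_setOf_posSemidef : IsClosed {A : Matrix n n ℂ | A.PosSemidef} := by
  simp only [posSemidef_iff_dotProduct_mulVec, Set.ofPred_and, Set.ofPred_forall]
  refine (isClosed_eq (by fun_prop) continuous_id).inter (isClosed_iInter fun x => ?_)
  exact isClosed_le continuous_const (by fun_prop)

end Matrix

section matrixRpow

variable {k : ℕ} {A B : Matrix (Fin k) (Fin k) ℂ}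

lemma matrixRpow_isHermitian (A : Matrix (Fin k) (Fin k) ℂ) (s : ℝ) :
    (matrixRpow A s).IsHermitian :=
  cfc_predicate (R := ℝ) (p := IsSelfAdjoint) (fun x : ℝ => x ^ s) A

lemma matrixRpow_zero (hA : A.PosDef) : matrixRpow A 0 = 1 := by
  have hA' : IsSelfAdjoint A := hA.1
  simp only [matrixRpow, Real.rpow_zero]
  exact cfc_const_one ℝ A

lemma matrixRpow_one (hA : A.PosDef) : matrixRpow A 1 = A := by
  have hA' : IsSelfAdjoint A := hA.1
  simp only [matrixRpow, Real.rpow_one]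
  exact cfc_id' ℝ A

lemma matrixRpow_add (hA : A.PosDef) (s t : ℝ) :
    matrixRpow A (s + t) = matrixRpow A s * matrixRpow A t := by
  have hfin : (spectrum ℝ A).Finite := A.finite_real_spectrum
  rw [matrixRpow, matrixRpow, matrixRpow, ← cfc_mul _ _ A (hfin.continuousOn _)
    (hfin.continuousOn _)]
  refine cfc_congr fun x hx => ?_
  rw [hA.1.spectrum_real_eq_range_eigenvalues] at hx
  obtain ⟨i, rfl⟩ := hx
  exact Real.rpow_add (hA.eigenvalues_pos i) s t

lemma matrixRpow_commute (h : Commute A B) (s t : ℝ) :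
    Commute (matrixRpow A s) (matrixRpow B t) :=
  ((h.cfc_real _).symm.cfc_real _).symm

lemma continuous_matrixRpow (hA : A.PosDef) : Continuous (matrixRpow A) := by
  have h : matrixRpow A = fun s => hA.1.cfc (fun x : ℝ => x ^ s) := by
    funext s
    exact hA.1.cfc_eq _
  rw [h]
  simp only [Matrix.IsHermitian.cfc, Unitary.conjStarAlgAut_apply]
  refine (continuous_const.matrix_mul (Continuous.matrix_diagonal ?_)).matrix_mul continuous_const
  refine continuous_pi fun i => Complex.continuous_ofReal.comp ?_
  exact Real.continuous_const_rpow (hA.eigenvalues_pos i).ne'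

end matrixRpow

/-- The product `L ^ p * R ^ q` as a function of the pair of exponents `(p, q)`. -/
noncomputable def matrixRpowMul {k : ℕ} (L R : Matrix (Fin k) (Fin k) ℂ) (x : ℝ × ℝ) :
    Matrix (Fin k) (Fin k) ℂ :=
  matrixRpow L x.1 * matrixRpow R x.2

section matrixRpowMul

variable {k : ℕ} {L R : Matrix (Fin k) (Fin k) ℂ}

lemma matrixRpowMul_isHermitian (h : Commute L R) (x : ℝ × ℝ) :
    (matrixRpowMul L R x).IsHermitian := by
  rw [Matrix.IsHermitian, matrixRpowMul, Matrix.conjTranspose_mul,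
    (matrixRpow_isHermitian _ _).eq, (matrixRpow_isHermitian _ _).eq]
  exact (matrixRpow_commute h _ _).eq.symm

lemma matrixRpowMul_zero (hL : L.PosDef) (hR : R.PosDef) : matrixRpowMul L R 0 = 1 := by
  simp [matrixRpowMul, matrixRpow_zero hL, matrixRpow_zero hR]

lemma matrixRpowMul_add (hL : L.PosDef) (hR : R.PosDef) (h : Commute L R) (x y : ℝ × ℝ) :
    matrixRpowMul L R (x + y) = matrixRpowMul L R x * matrixRpowMul L R y := by
  simp only [matrixRpowMul, Prod.fst_add, Prod.snd_add, matrixRpow_add hL, matrixRpow_add hR]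
  exact (matrixRpow_commute h _ _).mul_mul_mul_comm _ _

lemma matrixRpowMul_mul_neg (hL : L.PosDef) (hR : R.PosDef) (h : Commute L R) (x : ℝ × ℝ) :
    matrixRpowMul L R x * matrixRpowMul L R (-x) = 1 := by
  rw [← matrixRpowMul_add hL hR h, add_neg_cancel, matrixRpowMul_zero hL hR]

lemma matrixRpowMul_isUnit (hL : L.PosDef) (hR : R.PosDef) (h : Commute L R) (x : ℝ × ℝ) :
    IsUnit (matrixRpowMul L R x) :=
  IsUnit.of_mul_eq_one _ (matrixRpowMul_mul_neg hL hR h x)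

lemma matrixRpowMul_inv (hL : L.PosDef) (hR : R.PosDef) (h : Commute L R) (x : ℝ × ℝ) :
    (matrixRpowMul L R x)⁻¹ = matrixRpowMul L R (-x) :=
  Matrix.inv_eq_right_inv (matrixRpowMul_mul_neg hL hR h x)

lemma matrixRpowMul_posDef (hL : L.PosDef) (hR : R.PosDef) (h : Commute L R) (x : ℝ × ℝ) :
    (matrixRpowMul L R x).PosDef := by
  have e : matrixRpowMul L R x
      = (matrixRpowMul L R ((2⁻¹ : ℝ) • x))ᴴ * matrixRpowMul L R ((2⁻¹ : ℝ) • x) := by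
    rw [(matrixRpowMul_isHermitian h _).eq, ← matrixRpowMul_add hL hR h]
    congr 1
    module
  rw [e]
  exact Matrix.PosDef.conjTranspose_mul_self _
    (Matrix.mulVec_injective_of_isUnit (matrixRpowMul_isUnit hL hR h _))

lemma continuous_matrixRpowMul (hL : L.PosDef) (hR : R.PosDef) :
    Continuous (matrixRpowMul L R) :=
  ((continuous_matrixRpow hL).comp continuous_fst).matrix_mul
    ((continuous_matrixRpow hR).comp continuous_snd)

lemma matrixRpowMul_midpoint_mul (hL : L.PosDef) (hR : R.PosDef) (h : Commute L R)
    (x y : ℝ × ℝ) :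
    matrixRpowMul L R x = matrixRpowMul L R ((2⁻¹ : ℝ) • (x + y)) * (matrixRpowMul L R y)⁻¹
      * matrixRpowMul L R ((2⁻¹ : ℝ) • (x + y)) := by
  rw [matrixRpowMul_inv hL hR h, ← matrixRpowMul_add hL hR h, ← matrixRpowMul_add hL hR h]
  congr 1
  module

lemma posSemidef_fromBlocks_matrixRpowMul (hL : L.PosDef) (hR : R.PosDef) (h : Commute L R)
    (x y : ℝ × ℝ) :
    (Matrix.fromBlocks (matrixRpowMul L R x) (matrixRpowMul L R ((2⁻¹ : ℝ) • (x + y)))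
      (matrixRpowMul L R ((2⁻¹ : ℝ) • (x + y))) (matrixRpowMul L R y)).PosSemidef := by
  have hY := matrixRpowMul_posDef hL hR h y
  let _ := hY.isUnit.invertible
  have hG := matrixRpowMul_isHermitian h ((2⁻¹ : ℝ) • (x + y))
  have key := Matrix.PosDef.fromBlocks₂₂ (matrixRpowMul L R x)
    (matrixRpowMul L R ((2⁻¹ : ℝ) • (x + y))) hY
  rw [hG.eq, ← matrixRpowMul_midpoint_mul hL hR h, sub_self] at key
  exact key.2 Matrix.PosSemidef.zero

end matrixRpowMul

/-- The exponents at which `L ^ p * R ^ q` satisfies a given concavity inequality are closed under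
midpoints. -/
lemma posSemidef_matrixRpowMul_midpoint {k : ℕ} {L₁ R₁ L₂ R₂ L R : Matrix (Fin k) (Fin k) ℂ}
    (hL₁ : L₁.PosDef) (hR₁ : R₁.PosDef) (hL₂ : L₂.PosDef) (hR₂ : R₂.PosDef)
    (hL : L.PosDef) (hR : R.PosDef)
    (hc₁ : Commute L₁ R₁) (hc₂ : Commute L₂ R₂) (hc : Commute L R)
    {a b : ℝ} (ha : 0 ≤ a) (hb : 0 ≤ b) {x y : ℝ × ℝ}
    (hx : (matrixRpowMul L R x
      - (a • matrixRpowMul L₁ R₁ x + b • matrixRpowMul L₂ R₂ x)).PosSemidef)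
    (hy : (matrixRpowMul L R y
      - (a • matrixRpowMul L₁ R₁ y + b • matrixRpowMul L₂ R₂ y)).PosSemidef) :
    (matrixRpowMul L R ((2⁻¹ : ℝ) • (x + y))
      - (a • matrixRpowMul L₁ R₁ ((2⁻¹ : ℝ) • (x + y))
        + b • matrixRpowMul L₂ R₂ ((2⁻¹ : ℝ) • (x + y)))).PosSemidef := by
  set m := (2⁻¹ : ℝ) • (x + y) with hm
  have hZ : (a • matrixRpowMul L₁ R₁ m + b • matrixRpowMul L₂ R₂ m).IsHermitian :=
    ((matrixRpowMul_isHermitian hc₁ m).smul (IsSelfAdjoint.all a)).add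
      ((matrixRpowMul_isHermitian hc₂ m).smul (IsSelfAdjoint.all b))
  refine (matrixRpowMul_posDef hL hR hc m).posSemidef_sub_of_fromBlocks
    (matrixRpowMul_posDef hL hR hc y)
    (matrixRpowMul_isHermitian hc (-((2⁻¹ : ℝ) • y))) (matrixRpowMul_isUnit hL hR hc _)
    ?_ (matrixRpowMul_midpoint_mul hL hR hc x y) hZ ?_
  · rw [matrixRpowMul_inv hL hR hc, ← matrixRpowMul_add hL hR hc]
    congr 1
    module
  · have h₁ := (posSemidef_fromBlocks_matrixRpowMul hL₁ hR₁ hc₁ x y).smul ha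
    have h₂ := (posSemidef_fromBlocks_matrixRpowMul hL₂ hR₂ hc₂ x y).smul hb
    have h₃ := hx.fromBlocks_diagonal hy
    convert (h₁.add h₂).add h₃ using 1
    simp [Matrix.fromBlocks_smul, Matrix.fromBlocks_add, ← hm]

/-- For `0 ≤ s ≤ 1` and `0 ≤ t ≤ 1`, the map `(L,R) ↦ −Lˢ R^((1−s)t)` is jointly convex,
in the Loewner order, on commuting pairs of positive definite matrices. -/
theorem neg_rpow_mul_rpow_t_jointly_convex {k : ℕ} (s t : ℝ)
    (hs0 : 0 ≤ s) (hs1 : s ≤ 1) (ht0 : 0 ≤ t) (ht1 : t ≤ 1)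
    (L₁ R₁ L₂ R₂ L R : Matrix (Fin k) (Fin k) ℂ)
    (hL₁ : L₁.PosDef) (hR₁ : R₁.PosDef) (hL₂ : L₂.PosDef) (hR₂ : R₂.PosDef)
    (hc₁ : Commute L₁ R₁) (hc₂ : Commute L₂ R₂)
    (c : ℝ) (hc0 : 0 ≤ c) (hc1 : c ≤ 1)
    (hL : L = c • L₁ + (1 - c) • L₂) (hR : R = c • R₁ + (1 - c) • R₂)
    (hcLR : Commute L R) :
    (c • (-(matrixRpow L₁ s * matrixRpow R₁ ((1 - s) * t)))
      + (1 - c) • (-(matrixRpow L₂ s * matrixRpow R₂ ((1 - s) * t)))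
      - (-(matrixRpow L s * matrixRpow R ((1 - s) * t)))).PosSemidef := by
  have hd0 : 0 ≤ 1 - c := sub_nonneg.2 hc1
  have hcomb : ∀ {A B : Matrix (Fin k) (Fin k) ℂ}, A.PosDef → B.PosDef →
      (c • A + (1 - c) • B).PosDef := by
    intro A B hA hB
    rcases hc0.eq_or_lt with rfl | hpos
    · simpa using hB
    · exact (hA.smul hpos).add_posSemidef (hB.posSemidef.smul hd0)
  have hLp : L.PosDef := hL ▸ hcomb hL₁ hL₂
  have hRp : R.PosDef := hR ▸ hcomb hR₁ hR₂
  let S : Set (ℝ × ℝ) := {x | (matrixRpowMul L R x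
    - (c • matrixRpowMul L₁ R₁ x + (1 - c) • matrixRpowMul L₂ R₂ x)).PosSemidef}
  have hSclosed : IsClosed S := by
    have hcont : Continuous fun x => matrixRpowMul L R x
        - (c • matrixRpowMul L₁ R₁ x + (1 - c) • matrixRpowMul L₂ R₂ x) :=
      (continuous_matrixRpowMul hLp hRp).sub
        (((continuous_matrixRpowMul hL₁ hR₁).const_smul c).add
          ((continuous_matrixRpowMul hL₂ hR₂).const_smul (1 - c)))
    exact Matrix.isClosed_setOf_posSemidef.preimage hcont
  have hSconv : Convex ℝ S := convex_of_isClosed_of_midpoint_mem hSclosed fun x hx y hy =>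
    posSemidef_matrixRpowMul_midpoint hL₁ hR₁ hL₂ hR₂ hLp hRp hc₁ hc₂ hcLR hc0 hd0 hx hy
  have h00 : ((0, 0) : ℝ × ℝ) ∈ S := by
    simp [S, matrixRpowMul, matrixRpow_zero, *, ← add_smul, Matrix.PosSemidef.zero]
  have h10 : ((1, 0) : ℝ × ℝ) ∈ S := by
    simp only [S, Set.mem_ofPred_eq, matrixRpowMul, matrixRpow_zero, matrixRpow_one,
      hLp, hRp, hL₁, hR₁, hL₂, hR₂, mul_one, ← hL, sub_self]
    exact Matrix.PosSemidef.zero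
  have h01 : ((0, 1) : ℝ × ℝ) ∈ S := by
    simp only [S, Set.mem_ofPred_eq, matrixRpowMul, matrixRpow_zero, matrixRpow_one,
      hLp, hRp, hL₁, hR₁, hL₂, hR₂, one_mul, ← hR, sub_self]
    exact Matrix.PosSemidef.zero
  have h0t : ((0, t) : ℝ × ℝ) ∈ S := by
    simpa using hSconv h00 h01 (sub_nonneg.2 ht1) ht0 (by ring)
  have hst : ((s, (1 - s) * t) : ℝ × ℝ) ∈ S := by
    simpa using hSconv h10 h0t hs0 (sub_nonneg.2 hs1) (by ring)
  have hfinal : (matrixRpowMul L R (s, (1 - s) * t)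
    - (c • matrixRpowMul L₁ R₁ (s, (1 - s) * t)
      + (1 - c) • matrixRpowMul L₂ R₂ (s, (1 - s) * t))).PosSemidef := hst
  convert hfinal using 1
  simp only [matrixRpowMul]
  module
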